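/- There is an absolute constant C > 0 such that the following holds. Let n, m ≥ 2, let v̄_1, …, v̄_m ∈ ℝ^n be unit vectors, and let P be the random-bias vector P := (1/(10√(m log n))) ∑_{ℓ=1}^m ∑_{j ∈ J_ℓ} α_{ℓj} 2^j v̄_ℓ^{(j)} (with α_{ℓj} independent uniform on [-1,1]), conditioned on ‖P‖_∞ ≤ 1/2, and let x ~ μ_P. Write v = v̄_1 with binary decomposition v = ∑_{j∈J} v^{(j)} and coordinate classes K(j). If i ∈ J is such that at least 2r·log(n) elements of J are smaller than i, where r ≥ 0 is an integer, then for every t ∈ ℝ, ∑_{k ∈ K(i)} Pr[|⟨v,x⟩ - t| < 2|v_k|] ≤ C · (2^{-r} √m log(n) + |K(i)|/n), the probability being over both P and x ~ μ_P. -/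

import Mathlib

open MeasureTheory
open scoped Classical

/-- The dyadic class `K(j)` of the binary decomposition of `v`: the set of coordinates
`k` with `2^{-j-1} < |v k| ≤ 2^{-j}`. -/
noncomputable def binClass {n : ℕ} (v : Fin n → ℝ) (j : ℤ) : Finset (Fin n) :=
  Finset.univ.filter fun k => (2 : ℝ) ^ (-j - 1) < |v k| ∧ |v k| ≤ (2 : ℝ) ^ (-j)

/-- The index set `J` of the binary decomposition of `v`: those `j` with `K(j) ≠ ∅`. -/
def binIdx {n : ℕ} (v : Fin n → ℝ) : Set ℤ := {j | (binClass v j).Nonempty}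

/-- The piece `v^{(j)}` of the binary decomposition of `v`: it agrees with `v` on `K(j)`
and vanishes elsewhere, so that `v = ∑_{j ∈ J} v^{(j)}`. -/
noncomputable def binComp {n : ℕ} (v : Fin n → ℝ) (j : ℤ) : Fin n → ℝ :=
  fun k => if k ∈ binClass v j then v k else 0

/-- The uniform probability measure on the interval `[-1, 1] ⊂ ℝ`. -/
noncomputable def unifInterval : Measure ℝ :=
  (2⁻¹ : ENNReal) • volume.restrict (Set.Icc (-1 : ℝ) 1)

/-- A realization of the family `α = (α_{ℓ j})_{ℓ ∈ [m], j ∈ ℤ}` from a finite array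
`ω ∈ ℝ^{m × n}`: `α_{ℓ j} := ω_{ℓ k(j)}` where `k(j)` is a fixed representative of the
dyadic class `K_ℓ(j)` of `v_ℓ` (and `α_{ℓ j} := 0` for the irrelevant indices
`j ∉ J_ℓ`). Since the classes `K_ℓ(j)`, `j ∈ J_ℓ`, are pairwise disjoint, pushing
forward a product of uniform measures on `[-1,1]` by this map makes the variables
`α_{ℓ j}`, `ℓ ∈ [m]`, `j ∈ J_ℓ`, independent and uniform on `[-1,1]`. -/
noncomputable def alphaOf {n m : ℕ} (v : Fin m → Fin n → ℝ) (ω : Fin m → Fin n → ℝ) :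
    Fin m → ℤ → ℝ :=
  fun ℓ j => if h : (binClass (v ℓ) j).Nonempty then ω ℓ ((binClass (v ℓ) j).min' h) else 0

/-- The joint distribution of the coefficients `α_{ℓ j}` in Definition 2.2: the
`α_{ℓ j}`, `ℓ ∈ [m]`, `j ∈ J_ℓ`, are independent, uniformly distributed on `[-1,1]`. -/
noncomputable def alphaMeasure (n m : ℕ) (v : Fin m → Fin n → ℝ) :
    Measure (Fin m → ℤ → ℝ) :=
  Measure.map (alphaOf v) (Measure.pi fun _ : Fin m => Measure.pi fun _ : Fin n => unifInterval)

/-- The random bias vector of Definition 2.2: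
`P(α) = (1/(10√(m log n))) ∑_{ℓ=1}^m ∑_{j ∈ J_ℓ} α_{ℓ j} 2^j v_ℓ^{(j)}`,
where `v_ℓ = ∑_{j ∈ J_ℓ} v_ℓ^{(j)}` is the binary decomposition of `v_ℓ`.
(The sum over `j` is a `finsum`: all but finitely many terms vanish, since `v_ℓ^{(j)} = 0`
for `j ∉ J_ℓ`.) -/
noncomputable def biasP (n m : ℕ) (v : Fin m → Fin n → ℝ) (a : Fin m → ℤ → ℝ) :
    Fin n → ℝ :=
  fun k => (10 * Real.sqrt (m * Real.log n))⁻¹ *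
    ∑ ℓ, ∑ᶠ j : ℤ, a ℓ j * (2 : ℝ) ^ j * binComp (v ℓ) j k

/-- The biased product measure `μ_p` on `{-1,1}^n ⊂ ℝ^n`: coordinates are independent,
with `Pr[x i = 1] = (1 + p i)/2` and `Pr[x i = -1] = (1 - p i)/2`. -/
noncomputable def cubeMeasure {n : ℕ} (p : Fin n → ℝ) : Measure (Fin n → ℝ) :=
  Measure.pi fun i =>
    ENNReal.ofReal ((1 + p i) / 2) • Measure.dirac (1 : ℝ) +
      ENNReal.ofReal ((1 - p i) / 2) • Measure.dirac (-1 : ℝ)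

/-- The joint distribution of `(P, x)`, where `P` is the random bias vector of
Definition 2.2 (parametrized by `α`), conditioned on `‖P‖_∞ ≤ 1/2`, and, given `P`,
`x ~ μ_P`. -/
noncomputable def biasJoint (n m : ℕ) (v : Fin m → Fin n → ℝ) :
    Measure ((Fin m → ℤ → ℝ) × (Fin n → ℝ)) :=
  (ProbabilityTheory.cond (alphaMeasure n m v) {a | ∀ k, |biasP n m v a k| ≤ 1 / 2}).bind
    fun a => (cubeMeasure (biasP n m v a)).map (Prod.mk a)


noncomputable def sg (b : Bool) : ℝ := if b then 1 else -1
noncomputable def wt (p : ℝ) (b : Bool) : ℝ := (1 + sg b * p) / 2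
noncomputable def EE {n : ℕ} (p : Fin n → ℝ) (f : (Fin n → Bool) → ℝ) : ℝ :=
  ∑ s : Fin n → Bool, (∏ j, wt (p j) (s j)) * f s
def flp {n : ℕ} (k : Fin n) (s : Fin n → Bool) : Fin n → Bool := Function.update s k (!(s k))
noncomputable def SS {n : ℕ} (u : Fin n → ℝ) (s : Fin n → Bool) : ℝ := ∑ j, u j * sg (s j)

lemma flp_flp {n : ℕ} (k : Fin n) (s : Fin n → Bool) : flp k (flp k s) = s := by
  unfold flp; simp

lemma flp_inv {n : ℕ} (k : Fin n) : Function.Involutive (flp k) := flp_flp k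

lemma sum_flp {n : ℕ} (k : Fin n) (f : (Fin n → Bool) → ℝ) :
    ∑ s, f (flp k s) = ∑ s, f s :=
  Equiv.sum_comp (flp_inv k).toPerm f

lemma sg_not (b : Bool) : sg (!b) = - sg b := by cases b <;> simp [sg]

lemma SS_erase {n : ℕ} (u : Fin n → ℝ) (k : Fin n) (s : Fin n → Bool) :
    SS u s = SS (Function.update u k 0) s + u k * sg (s k) := by
  unfold SS
  rw [← Finset.add_sum_erase _ _ (Finset.mem_univ k),
    ← Finset.add_sum_erase _ (fun j => Function.update u k 0 j * sg (s j)) (Finset.mem_univ k)]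
  have : ∑ x ∈ Finset.univ.erase k, Function.update u k 0 x * sg (s x)
      = ∑ x ∈ Finset.univ.erase k, u x * sg (s x) := by
    apply Finset.sum_congr rfl
    intro x hx
    rw [Function.update_of_ne (Finset.ne_of_mem_erase hx)]
  rw [this]; simp; try ring

lemma SS_upd_flp {n : ℕ} (u : Fin n → ℝ) (k : Fin n) (s : Fin n → Bool) :
    SS (Function.update u k 0) (flp k s) = SS (Function.update u k 0) s := by
  unfold SS flp
  apply Finset.sum_congr rfl
  intro x _
  by_cases h : x = k
  · subst h; simp
  · simp [h]

lemma wt_nonneg {p : ℝ} (h : |p| ≤ 1) (b : Bool) : 0 ≤ wt p b := by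
  have := abs_le.1 h
  cases b <;> simp [wt, sg] <;> linarith

lemma wt_le {p : ℝ} (h : |p| ≤ 1/2) (b : Bool) : wt p b ≤ 3/4 := by
  have := abs_le.1 h
  cases b <;> simp [wt, sg] <;> linarith

lemma wt_add (p : ℝ) (b : Bool) : wt p b + wt p (!b) = 1 := by
  cases b <;> simp [wt, sg] <;> ring

noncomputable def RR {n : ℕ} (p : Fin n → ℝ) (k : Fin n) (s : Fin n → Bool) : ℝ :=
  ∏ j ∈ Finset.univ.erase k, wt (p j) (s j)

lemma RR_flp {n : ℕ} (p : Fin n → ℝ) (k : Fin n) (s : Fin n → Bool) :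
    RR p k (flp k s) = RR p k s := by
  unfold RR flp
  apply Finset.prod_congr rfl
  intro x hx
  rw [Function.update_of_ne (Finset.ne_of_mem_erase hx)]

lemma RR_nonneg {n : ℕ} {p : Fin n → ℝ} (hp : ∀ k, |p k| ≤ 1) (k : Fin n) (s : Fin n → Bool) :
    0 ≤ RR p k s := Finset.prod_nonneg fun j _ => wt_nonneg (hp j) _

lemma prod_RR {n : ℕ} (p : Fin n → ℝ) (k : Fin n) (s : Fin n → Bool) :
    ∏ j, wt (p j) (s j) = wt (p k) (s k) * RR p k s := by
  unfold RR
  rw [Finset.mul_prod_erase Finset.univ (fun j => wt (p j) (s j)) (Finset.mem_univ k)]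

/-- symmetrized formula -/
lemma EE_sym {n : ℕ} (p : Fin n → ℝ) (k : Fin n) (f : (Fin n → Bool) → ℝ) :
    EE p f = (1/2) * ∑ s, RR p k s * (wt (p k) (s k) * f s + wt (p k) (!(s k)) * f (flp k s)) := by
  have h1 : EE p f = ∑ s, wt (p k) (s k) * RR p k s * f s := by
    unfold EE; simp_rw [prod_RR p k]
  have h2 : EE p f = ∑ s, wt (p k) (!(s k)) * RR p k s * f (flp k s) := by
    rw [h1, ← sum_flp k]
    apply Finset.sum_congr rfl
    intro s _
    rw [RR_flp]; simp [flp]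
  have h3 : ∑ s, RR p k s * (wt (p k) (s k) * f s + wt (p k) (!(s k)) * f (flp k s))
      = EE p f + EE p f := by
    nth_rewrite 1 [h1]; rw [h2, ← Finset.sum_add_distrib]
    apply Finset.sum_congr rfl
    intro s _; ring
  rw [h3]; ring

lemma EE_indep {n : ℕ} (p : Fin n → ℝ) (k : Fin n) (h : (Fin n → Bool) → ℝ)
    (hh : ∀ s, h (flp k s) = h s) :
    EE p h = (1/2) * ∑ s, RR p k s * h s := by
  rw [EE_sym p k]
  congr 1
  apply Finset.sum_congr rfl
  intro s _
  rw [hh, ← add_mul, wt_add, one_mul]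

lemma EE_mono {n : ℕ} {p : Fin n → ℝ} (hp : ∀ k, |p k| ≤ 1) {f g : (Fin n → Bool) → ℝ}
    (h : ∀ s, f s ≤ g s) : EE p f ≤ EE p g := by
  unfold EE
  apply Finset.sum_le_sum
  intro s _
  exact mul_le_mul_of_nonneg_left (h s) (Finset.prod_nonneg fun j _ => wt_nonneg (hp j) _)

lemma EE_one {n : ℕ} (p : Fin n → ℝ) : EE p (fun _ => 1) = 1 := by
  unfold EE
  have := (Finset.prod_univ_sum (fun _ : Fin n => (Finset.univ : Finset Bool)) (fun j b => wt (p j) b))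
  simp only [mul_one]
  rw [Fintype.piFinset_univ] at this
  rw [← this]
  apply Finset.prod_eq_one
  intro j _
  simp [wt, sg]; ring

lemma EE_nonneg {n : ℕ} {p : Fin n → ℝ} (hp : ∀ k, |p k| ≤ 1) {f : (Fin n → Bool) → ℝ}
    (h : ∀ s, 0 ≤ f s) : 0 ≤ EE p f :=
  Finset.sum_nonneg fun s _ => mul_nonneg (Finset.prod_nonneg fun j _ => wt_nonneg (hp j) _) (h s)

noncomputable def win {n : ℕ} (u : Fin n → ℝ) (t w : ℝ) (s : Fin n → Bool) : ℝ :=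
  if |SS u s - t| < w then 1 else 0

lemma step {n : ℕ} {p : Fin n → ℝ} (hp : ∀ k, |p k| ≤ 1/2) (u : Fin n → ℝ) (t w : ℝ) (k : Fin n)
    (hk : w ≤ |u k|) :
    EE p (win u t w) ≤ 3/4 * EE p (win (Function.update u k 0) t (w + |u k|)) := by
  have hp1 : ∀ k, |p k| ≤ 1 := fun k => (hp k).trans (by norm_num)
  rw [EE_sym p k, EE_indep p k (win (Function.update u k 0) t (w + |u k|))
    (by intro s; unfold win; rw [SS_upd_flp])]
  have : ∑ s, RR p k s * (wt (p k) (s k) * win u t w s + wt (p k) (!(s k)) * win u t w (flp k s))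
      ≤ ∑ s, RR p k s * (3/4 * win (Function.update u k 0) t (w + |u k|) s) := by
    apply Finset.sum_le_sum
    intro s _
    apply mul_le_mul_of_nonneg_left _ (RR_nonneg hp1 k s)
    have key : win u t w s + win u t w (flp k s) ≤ win (Function.update u k 0) t (w + |u k|) s := by
      unfold win
      rw [SS_erase u k s, SS_erase u k (flp k s), SS_upd_flp]
      have : sg (flp k s k) = - sg (s k) := by simp [flp, sg_not]
      rw [this]
      have hs : sg (s k) = 1 ∨ sg (s k) = -1 := by
        cases s k <;> simp [sg]
      generalize SS (Function.update u k 0) s = X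
      rcases hs with hs | hs <;> rw [hs] <;> split_ifs <;> norm_num <;>
        simp only [abs_lt] at * <;> rcases abs_cases (u k) with ⟨h1, h2⟩ | ⟨h1, h2⟩ <;>
        rw [h1] at * <;> grind
    have n1 : 0 ≤ win u t w s := by unfold win; split_ifs <;> norm_num
    have n2 : 0 ≤ win u t w (flp k s) := by unfold win; split_ifs <;> norm_num
    have := mul_le_mul_of_nonneg_right (wt_le (hp k) (s k)) n1
    have := mul_le_mul_of_nonneg_right (wt_le (hp k) (!(s k))) n2
    linarith
  have e : ∑ s, RR p k s * (3/4 * win (Function.update u k 0) t (w + |u k|) s)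
    = 3/4 * ∑ s, RR p k s * win (Function.update u k 0) t (w + |u k|) s := by
    rw [Finset.mul_sum]; apply Finset.sum_congr rfl; intro s _; ring
  linarith

lemma partA {n : ℕ} {p : Fin n → ℝ} (hp : ∀ k, |p k| ≤ 1/2) (t : ℝ) (c : ℤ) (T : Finset ℤ) :
    ∀ (j0 : ℤ) (u : Fin n → ℝ) (w : ℝ), w ≤ 2 * (2:ℝ) ^ (-j0) →
      (∀ j ∈ T, j ≤ j0 - 2) → (∀ j ∈ T, j % 2 = c) →
      (∀ j ∈ T, ∃ k, (2:ℝ) ^ (-j - 1) < |u k| ∧ |u k| ≤ (2:ℝ) ^ (-j)) →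
      EE p (win u t w) ≤ (3/4) ^ T.card := by
  have hp1 : ∀ k, |p k| ≤ 1 := fun k => (hp k).trans (by norm_num)
  induction T using Finset.induction_on_max with
  | empty =>
    intro j0 u w _ _ _ _
    calc EE p (win u t w) ≤ EE p (fun _ => 1) := EE_mono hp1 (by intro s; unfold win; split_ifs <;> norm_num)
      _ = _ := by simp [EE_one]
  | insert a T hlt ih =>
    intro j0 u w hw h1 h2 h3
    obtain ⟨k, hk1, hk2⟩ := h3 a (by simp)
    have ha := h1 a (by simp)
    have e1 : (2:ℝ) * 2 ^ (-j0) ≤ 2 ^ (-a - 1) := by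
      rw [← zpow_one_add₀ (by norm_num)]
      apply zpow_le_zpow_right₀ (by norm_num); omega
    have e2 : (2:ℝ) * 2 ^ (-a - 1) = 2 ^ (-a) := by
      rw [← zpow_one_add₀ (by norm_num)]; congr 1; omega
    have e3 : (0:ℝ) < 2 ^ (-a) := by positivity
    have hn : a ∉ T := fun h => lt_irrefl _ (hlt a h)
    have s1 := step hp u t w k (by linarith)
    have s2 := ih a (Function.update u k 0) (w + |u k|) (by linarith)
      (by intro j hj; have := hlt j hj; have := h2 j (by simp [hj]); have := h2 a (by simp); omega)
      (fun j hj => h2 j (by simp [hj]))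
      (by
        intro j hj
        obtain ⟨k', a1, a2⟩ := h3 j (by simp [hj])
        have hne : k' ≠ k := by
          rintro rfl
          have : (2:ℝ) ^ (-a) ≤ 2 ^ (-j - 1) := by
            apply zpow_le_zpow_right₀ (by norm_num); have := hlt j hj; omega
          linarith
        exact ⟨k', by rw [Function.update_of_ne hne]; exact ⟨a1, a2⟩⟩)
    rw [Finset.card_insert_of_notMem hn, pow_succ]
    linarith

noncomputable def up {n : ℕ} (u : Fin n → ℝ) (t : ℝ) (s : Fin n → Bool) : ℝ :=
  if t ≤ SS u s then 1 else 0

noncomputable def hw {n : ℕ} (u : Fin n → ℝ) (k : Fin n) (t : ℝ) (s : Fin n → Bool) : ℝ :=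
  if t - |u k| ≤ SS (Function.update u k 0) s ∧ SS (Function.update u k 0) s < t + |u k| then 1 else 0

lemma hw_nonneg {n : ℕ} (u : Fin n → ℝ) (k : Fin n) (t : ℝ) (s : Fin n → Bool) : 0 ≤ hw u k t s := by
  unfold hw; split_ifs <;> norm_num

lemma up_nonneg {n : ℕ} (u : Fin n → ℝ) (t : ℝ) (s : Fin n → Bool) : 0 ≤ up u t s := by
  unfold up; split_ifs <;> norm_num

lemma up_le_one {n : ℕ} (u : Fin n → ℝ) (t : ℝ) (s : Fin n → Bool) : up u t s ≤ 1 := by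
  unfold up; split_ifs <;> norm_num

lemma win_nonneg {n : ℕ} (u : Fin n → ℝ) (t w : ℝ) (s : Fin n → Bool) : 0 ≤ win u t w s := by
  unfold win; split_ifs <;> norm_num

lemma EE_deriv {n : ℕ} (A b : Fin n → ℝ) (f : (Fin n → Bool) → ℝ) (y : ℝ) :
    HasDerivAt (fun y : ℝ => EE (fun k => A k + y * b k) f)
      (∑ k, b k * ∑ s, RR (fun k => A k + y * b k) k s * (sg (s k) / 2) * f s) y := by
  unfold EE
  have h : ∀ s : Fin n → Bool, HasDerivAt (fun y : ℝ => (∏ j, wt (A j + y * b j) (s j)) * f s)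
      ((∑ k, RR (fun k => A k + y * b k) k s • (sg (s k) * b k / 2)) * f s) y := by
    intro s
    apply HasDerivAt.mul_const
    apply HasDerivAt.fun_finsetProd
    intro k _
    unfold wt
    have := (((((hasDerivAt_id y).mul_const (b k)).const_add (A k)).const_mul (sg (s k))).const_add 1).div_const 2
    simpa using this
  have h2 := HasDerivAt.fun_sum (u := Finset.univ) (fun s _ => h s)
  suffices e : ∑ k, b k * ∑ s, RR (fun k => A k + y * b k) k s * (sg (s k) / 2) * f s =
      ∑ i, (∑ k, RR (fun k => A k + y * b k) k i • (sg (i k) * b k / 2)) * f i by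
    rw [e]; exact h2
  simp only [Finset.mul_sum, Finset.sum_mul]
  rw [Finset.sum_comm]
  apply Finset.sum_congr rfl; intro s _
  apply Finset.sum_congr rfl; intro k _
  simp only [smul_eq_mul]; ring

lemma deriv_term {n : ℕ} (p : Fin n → ℝ) (u : Fin n → ℝ) (t : ℝ) (k : Fin n) :
    u k * ∑ s, RR p k s * (sg (s k) / 2) * up u t s = |u k| / 2 * EE p (hw u k t) := by
  have h1 : ∑ s, RR p k s * (sg (s k) / 2) * up u t s =
      ∑ s, RR p k s * (- sg (s k) / 2) * up u t (flp k s) := by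
    rw [← sum_flp k]
    apply Finset.sum_congr rfl
    intro s _
    rw [RR_flp]; simp [flp, sg_not]
  have h2 : 2 * (u k * ∑ s, RR p k s * (sg (s k) / 2) * up u t s) =
      ∑ s, RR p k s * (1/2 * (u k * sg (s k) * (up u t s - up u t (flp k s)))) := by
    have : 2 * (u k * ∑ s, RR p k s * (sg (s k) / 2) * up u t s) =
      u k * ∑ s, RR p k s * (sg (s k) / 2) * up u t s +
      u k * ∑ s, RR p k s * (sg (s k) / 2) * up u t s := by ring
    rw [this]; nth_rewrite 2 [h1]
    rw [Finset.mul_sum, Finset.mul_sum, ← Finset.sum_add_distrib]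
    apply Finset.sum_congr rfl; intro s _; ring
  have h3 : ∀ s, u k * sg (s k) * (up u t s - up u t (flp k s)) = |u k| * hw u k t s := by
    intro s
    unfold up hw
    rw [SS_erase u k s, SS_erase u k (flp k s), SS_upd_flp]
    have : sg (flp k s k) = - sg (s k) := by simp [flp, sg_not]
    rw [this]
    have hs : sg (s k) = 1 ∨ sg (s k) = -1 := by
      cases s k <;> simp [sg]
    generalize SS (Function.update u k 0) s = X
    rcases hs with hs | hs <;> rw [hs] <;>
      rcases abs_cases (u k) with ⟨h1, h2⟩ | ⟨h1, h2⟩ <;> rw [h1] <;> split_ifs <;> grind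
  rw [EE_indep p k (hw u k t) (by intro s; unfold hw; rw [SS_upd_flp])]
  simp_rw [h3] at h2
  have h4 : ∑ s, RR p k s * (1/2 * (|u k| * hw u k t s)) = 1/2 * |u k| * ∑ s, RR p k s * hw u k t s := by
    rw [Finset.mul_sum]; apply Finset.sum_congr rfl; intro s _; ring
  linarith

lemma EE_sum {n : ℕ} {ι : Type*} (p : Fin n → ℝ) (S : Finset ι) (f : ι → (Fin n → Bool) → ℝ) :
    EE p (fun s => ∑ l ∈ S, f l s) = ∑ l ∈ S, EE p (f l) := by
  unfold EE
  simp_rw [Finset.mul_sum]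
  rw [Finset.sum_comm]

lemma cover {n : ℕ} (u : Fin n → ℝ) (k : Fin n) (t δ : ℝ) (hδ : 0 < δ) (h1 : δ / 2 < |u k|)
    (h2 : |u k| ≤ δ) (s : Fin n → Bool) :
    win u t (2 * δ) s ≤ ∑ l ∈ Finset.Icc (-3:ℤ) 3, hw u k (t + l * δ) s := by
  unfold win
  split_ifs with h
  · rw [SS_erase u k s] at h
    set X := SS (Function.update u k 0) s with hX
    have hs : sg (s k) = 1 ∨ sg (s k) = -1 := by
      cases s k <;> simp [sg]
    have hb : t - 3 * δ < X ∧ X < t + 3 * δ := by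
      rw [abs_lt] at h
      have := abs_le.1 h2
      rcases hs with hs | hs <;> rw [hs] at h <;> constructor <;> linarith
    set l := ⌊(X - t) / δ + 1/2⌋ with hl
    have f1 := Int.floor_le ((X - t) / δ + 1/2)
    have f2 := Int.lt_floor_add_one ((X - t) / δ + 1/2)
    rw [← hl] at f1 f2
    have g1 : (l:ℝ) * δ ≤ (X - t) + δ / 2 := by
      have := mul_le_mul_of_nonneg_right f1 hδ.le
      have e : ((X - t) / δ + 1/2) * δ = (X - t) + δ/2 := by field_simp
      linarith
    have g2 : (X - t) + δ / 2 < (l + 1:ℝ) * δ := by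
      have := mul_lt_mul_of_pos_right f2 hδ
      have e : ((X - t) / δ + 1/2) * δ = (X - t) + δ/2 := by field_simp
      linarith
    have l1 : l < 4 := by
      have : (l:ℝ) < 4 := by
        by_contra hc; push Not at hc; nlinarith
      exact_mod_cast this
    have l2 : -4 < l := by
      have : (-4:ℝ) < l := by
        by_contra hc; push Not at hc; nlinarith
      exact_mod_cast this
    have hm : l ∈ Finset.Icc (-3:ℤ) 3 := by simp; omega
    refine le_trans ?_ (Finset.single_le_sum (f := fun l : ℤ => hw u k (t + l * δ) s) (fun l _ => hw_nonneg _ _ _ _) hm)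
    simp only [hw]
    rw [if_pos]
    rw [← hX]
    constructor <;> linarith
  · exact Finset.sum_nonneg fun l _ => hw_nonneg _ _ _ _

/-- one-parameter anticoncentration -/
lemma partB {n : ℕ} (A u : Fin n → ℝ) (K : Finset (Fin n)) (b : Fin n → ℝ) (c δ : ℝ) (hc : 0 < c)
    (hδ : 0 < δ) (hK : ∀ k ∈ K, δ / 2 < |u k| ∧ |u k| ≤ δ)
    (hb : ∀ k, b k = if k ∈ K then c * δ⁻¹ * u k else 0) (t : ℝ) :
    (K.card : ENNReal) * ∫⁻ y in {y : ℝ | y ∈ Set.Icc (-1:ℝ) 1 ∧ ∀ k, |A k + y * b k| ≤ 1/2},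
      ENNReal.ofReal (EE (fun k => A k + y * b k) (win u t (2 * δ))) ≤ ENNReal.ofReal (28 / c) := by
  set I := {y : ℝ | y ∈ Set.Icc (-1:ℝ) 1 ∧ ∀ k, |A k + y * b k| ≤ 1/2} with hI
  by_cases hne : I.Nonempty
  swap
  · rw [Set.not_nonempty_iff_eq_empty.1 hne]; simp
  have hcl : IsClosed I := by
    rw [hI, Set.ofPred_and]
    apply IsClosed.inter isClosed_Icc
    rw [Set.ofPred_forall]
    apply isClosed_iInter
    intro k
    exact isClosed_le (by fun_prop) (by fun_prop)
  have hcomp : IsCompact I := isCompact_Icc.of_isClosed_subset hcl (fun y hy => hy.1)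
  have hconv : Convex ℝ I := by
    intro x hx y hy a1 a2 ha1 ha2 hs
    refine ⟨convex_Icc _ _ hx.1 hy.1 ha1 ha2 hs, fun k => ?_⟩
    have h1 := abs_le.1 (hx.2 k); have h2 := abs_le.1 (hy.2 k)
    simp only [smul_eq_mul]
    have e : A k + (a1 * x + a2 * y) * b k = a1 * (A k + x * b k) + a2 * (A k + y * b k) := by
      linear_combination (-A k) * hs
    rw [e, abs_le]
    constructor <;> nlinarith
  have hIcc := eq_Icc_of_connected_compact ⟨hne, hconv.isPreconnected⟩ hcomp
  set lo := sInf I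
  set hi := sSup I
  have hlh : lo ≤ hi := by
    rw [hIcc] at hne; exact Set.nonempty_Icc.1 hne
  have hlo : lo ∈ I := by rw [hIcc]; exact ⟨le_rfl, hlh⟩
  have hhi : hi ∈ I := by rw [hIcc]; exact ⟨hlh, le_rfl⟩
  set G : ℝ → ℝ := fun y => ∑ l ∈ Finset.Icc (-3:ℤ) 3, EE (fun k => A k + y * b k) (up u (t + l * δ)) with hG
  set G' : ℝ → ℝ := fun y => ∑ l ∈ Finset.Icc (-3:ℤ) 3, (∑ k, b k * ∑ s, RR (fun k => A k + y * b k) k s * (sg (s k) / 2) * up u (t + l * δ) s) with hG'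
  have hd : ∀ y, HasDerivAt G (G' y) y := fun y =>
    HasDerivAt.fun_sum (fun l _ => EE_deriv A b _ y)
  have hcont : Continuous G' := by
    simp only [hG']; unfold RR wt; fun_prop
  have habs : ∀ y ∈ I, ∀ k, |A k + y * b k| ≤ 1 := fun y hy k => (hy.2 k).trans (by norm_num)
  have key : ∀ y ∈ I, (K.card:ℝ) * EE (fun k => A k + y * b k) (win u t (2 * δ)) ≤ (4 / c) * G' y := by
    intro y hy
    have hp := habs y hy
    set p := (fun k => A k + y * b k) with hpdef
    have h1 : (K.card:ℝ) * EE p (win u t (2 * δ)) ≤ ∑ k ∈ K, ∑ l ∈ Finset.Icc (-3:ℤ) 3, EE p (hw u k (t + l * δ)) := by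
      rw [← nsmul_eq_mul]
      apply Finset.card_nsmul_le_sum
      intro k hk
      rw [← EE_sum]
      exact EE_mono hp (cover u k t δ hδ (hK k hk).1 (hK k hk).2)
    refine h1.trans ?_
    rw [Finset.sum_comm, hG']
    simp only
    rw [Finset.mul_sum]
    apply Finset.sum_le_sum
    intro l _
    rw [Finset.mul_sum]
    rw [← Finset.sum_subset (Finset.subset_univ K) (by intro k _ hk; rw [hb k, if_neg hk]; ring)]
    apply Finset.sum_le_sum
    intro k hk
    have e : b k * ∑ s, RR p k s * (sg (s k) / 2) * up u (t + l * δ) s = c * δ⁻¹ * (|u k| / 2 * EE p (hw u k (t + l * δ))) := by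
      rw [← deriv_term, hb k, if_pos hk]; ring
    rw [e]
    have e2 : 4 / c * (c * δ⁻¹ * (|u k| / 2 * EE p (hw u k (t + l * δ)))) = (2 * |u k| / δ) * EE p (hw u k (t + l * δ)) := by
      field_simp; ring
    rw [e2]
    have : 1 ≤ 2 * |u k| / δ := by
      rw [le_div_iff₀ hδ]; have := (hK k hk).1; linarith
    exact le_mul_of_one_le_left (EE_nonneg hp (hw_nonneg _ _ _)) this
  have hG0 : ∀ y ∈ I, 0 ≤ G y ∧ G y ≤ 7 := by
    intro y hy
    constructor
    · exact Finset.sum_nonneg fun l _ => EE_nonneg (habs y hy) (up_nonneg _ _)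
    · have : G y ≤ ∑ l ∈ Finset.Icc (-3:ℤ) 3, (1:ℝ) := by
        apply Finset.sum_le_sum
        intro l _
        rw [← EE_one (fun k => A k + y * b k)]
        exact EE_mono (habs y hy) (up_le_one _ _)
      simpa using this
  have hmI : MeasurableSet I := hcl.measurableSet
  have hG'n : ∀ y ∈ I, 0 ≤ 4 / c * G' y := fun y hy => le_trans (mul_nonneg (Nat.cast_nonneg _)
    (EE_nonneg (habs y hy) (win_nonneg _ _ _))) (key y hy)
  have hint : ∫ y in I, 4 / c * G' y ≤ 28 / c := by
    rw [hIcc, integral_Icc_eq_integral_Ioc, ← intervalIntegral.integral_of_le hlh,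
      intervalIntegral.integral_const_mul,
      intervalIntegral.integral_eq_sub_of_hasDerivAt (fun y _ => hd y) (hcont.intervalIntegrable _ _)]
    have h1 := hG0 _ hlo
    have h2 := hG0 _ hhi
    have : 28 / c = 4 / c * 7 := by ring
    rw [this]
    apply mul_le_mul_of_nonneg_left _ (by positivity)
    linarith
  calc (K.card : ENNReal) * ∫⁻ y in I, ENNReal.ofReal (EE (fun k => A k + y * b k) (win u t (2 * δ)))
      = ∫⁻ y in I, (K.card : ENNReal) * ENNReal.ofReal (EE (fun k => A k + y * b k) (win u t (2 * δ))) := by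
        rw [lintegral_const_mul' _ _ (by simp)]
    _ ≤ ∫⁻ y in I, ENNReal.ofReal (4 / c * G' y) := by
        apply setLIntegral_mono' hmI
        intro y hy
        rw [← ENNReal.ofReal_natCast, ← ENNReal.ofReal_mul (Nat.cast_nonneg _)]
        exact ENNReal.ofReal_le_ofReal (key y hy)
    _ = ENNReal.ofReal (∫ y in I, 4 / c * G' y) := by
        rw [ofReal_integral_eq_lintegral_ofReal]
        · exact ((continuous_const.mul hcont).continuousOn.integrableOn_compact hcomp)
        · exact (ae_restrict_iff' hmI).2 (Filter.Eventually.of_forall hG'n)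
    _ ≤ _ := ENNReal.ofReal_le_ofReal hint

instance unif_prob : IsProbabilityMeasure unifInterval := by
  constructor
  unfold unifInterval
  simp only [Measure.smul_apply, Measure.restrict_apply_univ, Real.volume_Icc, smul_eq_mul]
  norm_num
  exact ENNReal.inv_mul_cancel (by norm_num) (by norm_num)

lemma cube_eq {n : ℕ} (p : Fin n → ℝ) :
    cubeMeasure p = Measure.sum (fun s : Fin n → Bool =>
      (∏ j, ENNReal.ofReal (wt (p j) (s j))) • Measure.dirac (fun j => sg (s j))) := by
  unfold cubeMeasure
  have hfin : ∀ i, IsFiniteMeasure (ENNReal.ofReal ((1 + p i) / 2) • Measure.dirac (1 : ℝ) +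
      ENNReal.ofReal ((1 - p i) / 2) • Measure.dirac (-1 : ℝ)) := by
    intro i
    constructor
    simp [ENNReal.add_lt_top]
  apply Measure.pi_eq
  intro B hB
  rw [Measure.sum_apply _ (MeasurableSet.univ_pi hB), tsum_fintype]
  have h := (Finset.prod_univ_sum (fun _ : Fin n => (Finset.univ : Finset Bool))
    (fun j b => ENNReal.ofReal (wt (p j) b) * (B j).indicator 1 (sg b)))
  rw [Fintype.piFinset_univ] at h
  have h2 : ∀ i, (ENNReal.ofReal ((1 + p i) / 2) • Measure.dirac (1 : ℝ) +
      ENNReal.ofReal ((1 - p i) / 2) • Measure.dirac (-1 : ℝ)) (B i) =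
      ∑ b : Bool, ENNReal.ofReal (wt (p i) b) * (B i).indicator 1 (sg b) := by
    intro i
    simp [wt, sg, Measure.dirac_apply' _ (hB i), sub_eq_add_neg]
  simp_rw [h2]
  rw [h]
  apply Finset.sum_congr rfl
  intro s _
  rw [Finset.prod_mul_distrib, Measure.smul_apply, Measure.dirac_apply' _ (MeasurableSet.univ_pi hB), smul_eq_mul]
  congr 1
  by_cases hs : (fun j => sg (s j)) ∈ Set.univ.pi B
  · rw [Set.indicator_of_mem hs]
    symm
    apply Finset.prod_eq_one
    intro j _
    rw [Set.indicator_of_mem (hs j trivial)]; rfl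
  · rw [Set.indicator_of_notMem hs]
    simp only [Set.mem_univ_pi, not_forall] at hs
    obtain ⟨j, hj⟩ := hs
    symm
    exact Finset.prod_eq_zero (Finset.mem_univ j) (Set.indicator_of_notMem hj _)

lemma meas_win {n : ℕ} (u : Fin n → ℝ) (t w : ℝ) :
    MeasurableSet {x : Fin n → ℝ | |(∑ j, u j * x j) - t| < w} :=
  measurableSet_lt (by fun_prop) (by fun_prop)

lemma cube_win {n : ℕ} (p : Fin n → ℝ) (hp : ∀ k, |p k| ≤ 1) (u : Fin n → ℝ) (t w : ℝ) :
    cubeMeasure p {x | |(∑ j, u j * x j) - t| < w} = ENNReal.ofReal (EE p (win u t w)) := by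
  rw [cube_eq, Measure.sum_apply _ (meas_win u t w), tsum_fintype]
  unfold EE
  rw [ENNReal.ofReal_sum_of_nonneg (fun s _ => mul_nonneg (Finset.prod_nonneg fun j _ => wt_nonneg (hp j) _) (win_nonneg _ _ _ _))]
  apply Finset.sum_congr rfl
  intro s _
  rw [ENNReal.ofReal_mul (Finset.prod_nonneg fun j _ => wt_nonneg (hp j) _),
    ENNReal.ofReal_prod_of_nonneg (fun j _ => wt_nonneg (hp j) _), Measure.smul_apply,
    Measure.dirac_apply' _ (meas_win u t w), smul_eq_mul]
  congr 1
  unfold win SS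
  by_cases h : |(∑ j, u j * sg (s j)) - t| < w
  · rw [Set.indicator_of_mem (by exact h), if_pos h]; simp
  · rw [Set.indicator_of_notMem (by exact h), if_neg h]; simp

lemma binClass_unique {n : ℕ} {v : Fin n → ℝ} {i j : ℤ} {k : Fin n} (hi : k ∈ binClass v i)
    (hj : k ∈ binClass v j) : i = j := by
  simp only [binClass, Finset.mem_filter, Finset.mem_univ, true_and] at hi hj
  have h1 := (zpow_lt_zpow_iff_right₀ (by norm_num : (1:ℝ) < 2)).1 (hi.1.trans_le hj.2)
  have h2 := (zpow_lt_zpow_iff_right₀ (by norm_num : (1:ℝ) < 2)).1 (hj.1.trans_le hi.2)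
  omega

lemma binClass_exists {n : ℕ} {v : Fin n → ℝ} {k : Fin n} (h : v k ≠ 0) :
    ∃ j, k ∈ binClass v j := by
  obtain ⟨N, h1, h2⟩ := exists_mem_Ioc_zpow (abs_pos.2 h) (by norm_num : (1:ℝ) < 2)
  refine ⟨-N - 1, ?_⟩
  simp only [binClass, Finset.mem_filter, Finset.mem_univ, true_and]
  constructor
  · have e : -(-N - 1) - 1 = N := by omega
    rw [e]; exact h1
  · have e : -(-N - 1) = N + 1 := by omega
    rw [e]; exact h2

lemma fs_mem {n : ℕ} {v : Fin n → ℝ} {i : ℤ} {k : Fin n} (hi : k ∈ binClass v i) (a : ℤ → ℝ) :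
    ∑ᶠ j : ℤ, a j * (2 : ℝ) ^ j * binComp v j k = a i * (2:ℝ) ^ i * v k := by
  rw [finsum_eq_single _ i]
  · simp [binComp, hi]
  · intro j hj
    have : k ∉ binClass v j := fun h => hj (binClass_unique h hi)
    simp [binComp, this]

lemma fs_zero {n : ℕ} {v : Fin n → ℝ} {k : Fin n} (h : v k = 0) (a : ℤ → ℝ) :
    ∑ᶠ j : ℤ, a j * (2 : ℝ) ^ j * binComp v j k = 0 := by
  have : ∀ j, a j * (2 : ℝ) ^ j * binComp v j k = 0 := by
    intro j; simp [binComp, h]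
  simp [this]

lemma coef_le {n : ℕ} {v : Fin n → ℝ} {i : ℤ} {k : Fin n} (hi : k ∈ binClass v i) :
    |(2:ℝ) ^ i * v k| ≤ 1 := by
  simp only [binClass, Finset.mem_filter, Finset.mem_univ, true_and] at hi
  rw [abs_mul, abs_of_pos (by positivity : (0:ℝ) < 2 ^ i)]
  calc (2:ℝ) ^ i * |v k| ≤ 2 ^ i * 2 ^ (-i) := by gcongr; exact hi.2
    _ = 1 := by rw [← zpow_add₀ (by norm_num)]; simp

lemma fs_lin {n : ℕ} (v : Fin n → ℝ) (k : Fin n) :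
    ∃ (q : ℝ) (i : ℤ), ∀ a : ℤ → ℝ, ∑ᶠ j : ℤ, a j * (2 : ℝ) ^ j * binComp v j k = q * a i := by
  by_cases h : v k = 0
  · exact ⟨0, 0, fun a => by rw [fs_zero h]; simp⟩
  · obtain ⟨i, hi⟩ := binClass_exists h
    exact ⟨2 ^ i * v k, i, fun a => by rw [fs_mem hi]; ring⟩

lemma fs_alpha {n m : ℕ} (v : Fin m → Fin n → ℝ) (ℓ : Fin m) (k : Fin n) :
    ∃ (q : ℝ) (k' : Fin n), |q| ≤ 1 ∧ ∀ ω : Fin m → Fin n → ℝ,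
      ∑ᶠ j : ℤ, alphaOf v ω ℓ j * (2 : ℝ) ^ j * binComp (v ℓ) j k = q * ω ℓ k' := by
  by_cases h : v ℓ k = 0
  · exact ⟨0, k, by simp, fun a => by rw [fs_zero h]; simp⟩
  · obtain ⟨i, hi⟩ := binClass_exists h
    refine ⟨2 ^ i * v ℓ k, (binClass (v ℓ) i).min' ⟨k, hi⟩, coef_le hi, fun ω => ?_⟩
    rw [fs_mem hi, alphaOf, dif_pos ⟨k, hi⟩]; ring

lemma meas_bias (n m : ℕ) (v : Fin m → Fin n → ℝ) (k : Fin n) :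
    Measurable (fun a => biasP n m v a k) := by
  unfold biasP
  apply Measurable.const_mul
  apply Finset.measurable_sum
  intro ℓ _
  obtain ⟨q, i, h⟩ := fs_lin (v ℓ) k
  simp_rw [h]
  fun_prop

lemma meas_alphaOf {n m : ℕ} (v : Fin m → Fin n → ℝ) : Measurable (alphaOf v) := by
  rw [measurable_pi_iff]; intro ℓ
  rw [measurable_pi_iff]; intro j
  unfold alphaOf
  split_ifs <;> fun_prop

lemma meas_D (n m : ℕ) (v : Fin m → Fin n → ℝ) :
    MeasurableSet {a | ∀ k, |biasP n m v a k| ≤ 1 / 2} := by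
  rw [Set.ofPred_forall]
  exact MeasurableSet.iInter fun k => measurableSet_le (measurable_abs.comp (meas_bias n m v k)) measurable_const

lemma resample {ι : Type*} [Fintype ι] [DecidableEq ι] {α : ι → Type*} [∀ i, MeasurableSpace (α i)] (μ : ∀ i, Measure (α i))
    [∀ i, IsProbabilityMeasure (μ i)] (k : ι) (f : (∀ i, α i) → ENNReal) (hf : Measurable f) :
    ∫⁻ x, f x ∂(Measure.pi μ) = ∫⁻ x, ∫⁻ y, f (Function.update x k y) ∂(μ k) ∂(Measure.pi μ) := by
  have hu : Measurable (fun q : (∀ i, α i) × α k => Function.update q.1 k q.2) := by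
    rw [measurable_pi_iff]; intro i
    by_cases h : i = k
    · subst h; simp only [Function.update_self]; exact measurable_snd
    · simp only [Function.update_of_ne h]; fun_prop
  have h : Measure.pi μ = Measure.map (fun q : (∀ i, α i) × α k => Function.update q.1 k q.2)
      ((Measure.pi μ).prod (μ k)) := by
    apply Measure.pi_eq
    intro B hB
    rw [Measure.map_apply hu (MeasurableSet.univ_pi hB)]
    have e : (fun q : (∀ i, α i) × α k => Function.update q.1 k q.2) ⁻¹' (Set.univ.pi B) =
        (Set.univ.pi (Function.update B k Set.univ)) ×ˢ (B k) := by
      ext ⟨x, y⟩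
      simp only [Set.mem_preimage, Set.mem_univ_pi, Set.mem_prod]
      constructor
      · intro h
        refine ⟨fun i => ?_, by simpa using h k⟩
        by_cases hi : i = k
        · subst hi; simp
        · simpa [hi] using h i
      · rintro ⟨h1, h2⟩ i
        by_cases hi : i = k
        · subst hi; simpa using h2
        · simpa [hi] using h1 i
    rw [e, Measure.prod_prod, Measure.pi_pi, ← Finset.mul_prod_erase _ _ (Finset.mem_univ k),
      ← Finset.mul_prod_erase _ (fun i => μ i (B i)) (Finset.mem_univ k)]
    simp only [Function.update_self, measure_univ, one_mul]
    rw [mul_comm]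
    congr 1
    apply Finset.prod_congr rfl
    intro i hi
    rw [Function.update_of_ne (Finset.ne_of_mem_erase hi)]
  conv_lhs => rw [h]
  rw [lintegral_map hf hu, lintegral_prod (fun q : (∀ i, α i) × α k => f (Function.update q.1 k q.2)) (hf.comp hu).aemeasurable]

lemma unif_mean : ∫ y, y ∂unifInterval = 0 := by
  unfold unifInterval
  rw [integral_smul_measure, integral_Icc_eq_integral_Ioc,
    ← intervalIntegral.integral_of_le (by norm_num), integral_id]
  norm_num

lemma unif_ae : ∀ᵐ y ∂unifInterval, y ∈ Set.Icc (-1:ℝ) 1 := by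
  unfold unifInterval
  apply Measure.ae_smul_measure
  exact ae_restrict_mem measurableSet_Icc

lemma hoeff {n m : ℕ} (hn : 2 ≤ n) (hm : 2 ≤ m) (q : Fin m → ℝ) (hq : ∀ ℓ, |q ℓ| ≤ 1)
    (k' : Fin m → Fin n) :
    (Measure.pi fun _ : Fin m => Measure.pi fun _ : Fin n => unifInterval).real
      {ω | 5 * Real.sqrt (m * Real.log n) ≤ ∑ ℓ, q ℓ * ω ℓ (k' ℓ)} ≤ 1 / (n:ℝ)^3 := by
  have hlog : 0 < Real.log n := Real.log_pos (by exact_mod_cast hn)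
  have hm0 : (0:ℝ) < m := by positivity
  have hme : ∀ ℓ : Fin m, AEMeasurable (fun z : Fin n → ℝ => q ℓ * z (k' ℓ))
      (Measure.pi fun _ : Fin n => unifInterval) := by
    intro ℓ
    have h0 : Measurable (fun z : Fin n → ℝ => z (k' ℓ)) := measurable_pi_apply (k' ℓ)
    exact (h0.const_mul (q ℓ)).aemeasurable
  have hind := ProbabilityTheory.iIndepFun_pi (μ := fun _ : Fin m => Measure.pi fun _ : Fin n => unifInterval)
    (X := fun (ℓ : Fin m) (z : Fin n → ℝ) => q ℓ * z (k' ℓ)) hme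
  have hmp : ∀ ℓ, MeasurePreserving (fun ω : Fin m → Fin n → ℝ => ω ℓ (k' ℓ))
      (Measure.pi fun _ : Fin m => Measure.pi fun _ : Fin n => unifInterval) unifInterval := fun ℓ =>
    (measurePreserving_eval (fun _ : Fin n => unifInterval) (k' ℓ)).comp
      (measurePreserving_eval (fun _ : Fin m => Measure.pi fun _ : Fin n => unifInterval) ℓ)
  have hsub : ∀ ℓ ∈ (Finset.univ : Finset (Fin m)), ProbabilityTheory.HasSubgaussianMGF
      (fun ω : Fin m → Fin n → ℝ => q ℓ * ω ℓ (k' ℓ)) ((‖(1:ℝ) - (-1)‖₊ / 2) ^ 2)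
      (Measure.pi fun _ : Fin m => Measure.pi fun _ : Fin n => unifInterval) := by
    intro ℓ _
    apply ProbabilityTheory.hasSubgaussianMGF_of_mem_Icc_of_integral_eq_zero
    · exact ((hmp ℓ).measurable.const_mul (q ℓ)).aemeasurable
    · have := (hmp ℓ).quasiMeasurePreserving.ae unif_ae
      filter_upwards [this] with ω hω
      have h1 : |ω ℓ (k' ℓ)| ≤ 1 := abs_le.2 hω
      apply abs_le.1
      rw [abs_mul]
      exact mul_le_one₀ (hq ℓ) (abs_nonneg _) h1
    · rw [integral_const_mul]
      have : ∫ ω : Fin m → Fin n → ℝ, ω ℓ (k' ℓ) ∂(Measure.pi fun _ : Fin m => Measure.pi fun _ : Fin n => unifInterval) = ∫ y, y ∂unifInterval := by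
        conv_rhs => rw [← (hmp ℓ).map_eq]
        rw [integral_map (hmp ℓ).measurable.aemeasurable (by fun_prop)]
      rw [this, unif_mean, mul_zero]
  have := ProbabilityTheory.HasSubgaussianMGF.measure_sum_ge_le_of_iIndepFun hind hsub
    (ε := 5 * Real.sqrt (m * Real.log n)) (by positivity)
  refine this.trans ?_
  have e : ((∑ i : Fin m, (‖(1:ℝ) - (-1)‖₊ / 2) ^ 2 : NNReal) : ℝ) = m := by
    norm_num
  rw [e, mul_pow, Real.sq_sqrt (by positivity)]
  have e2 : -(5 ^ 2 * ((m:ℝ) * Real.log n)) / (2 * m) = - (25/2 * Real.log n) := by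
    field_simp; norm_num
  rw [e2]
  have e3 : 1 / (n:ℝ)^3 = Real.exp (-(3 * Real.log n)) := by
    rw [Real.exp_neg, mul_comm, Real.exp_mul, Real.exp_log (by positivity)]
    norm_num
  rw [e3]
  apply Real.exp_le_exp.2
  linarith

lemma Z_lower {n m : ℕ} (hn : 2 ≤ n) (hm : 2 ≤ m) (v : Fin m → Fin n → ℝ) :
    (2⁻¹ : ENNReal) ≤ alphaMeasure n m v {a | ∀ k, |biasP n m v a k| ≤ 1 / 2} := by
  have hlog : 0 < Real.log n := Real.log_pos (by exact_mod_cast hn)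
  have hm0 : (0:ℝ) < m := by positivity
  set c := 10 * Real.sqrt (m * Real.log n) with hc
  have hcpos : 0 < c := by positivity
  set μ := (Measure.pi fun _ : Fin m => Measure.pi fun _ : Fin n => unifInterval) with hμ
  choose q k' hq hqq using fun (k : Fin n) (ℓ : Fin m) => fs_alpha v ℓ k
  have hD := meas_D n m v
  unfold alphaMeasure
  rw [Measure.map_apply (meas_alphaOf v) hD]
  set S := alphaOf v ⁻¹' {a | ∀ k, |biasP n m v a k| ≤ 1 / 2} with hS
  have hSm : MeasurableSet S := meas_alphaOf v hD
  have hsub : Sᶜ ⊆ ⋃ k : Fin n, ({ω | 5 * Real.sqrt (m * Real.log n) ≤ ∑ ℓ, q k ℓ * ω ℓ (k' k ℓ)} ∪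
      {ω | 5 * Real.sqrt (m * Real.log n) ≤ ∑ ℓ, (-q k ℓ) * ω ℓ (k' k ℓ)}) := by
    intro ω hω
    simp only [hS, Set.mem_compl_iff, Set.mem_preimage, Set.mem_ofPred_eq, not_forall, not_le] at hω
    obtain ⟨k, hk⟩ := hω
    rw [Set.mem_iUnion]
    refine ⟨k, ?_⟩
    unfold biasP at hk
    simp_rw [hqq k] at hk
    rw [abs_mul, abs_of_pos (inv_pos.2 hcpos), inv_mul_eq_div, lt_div_iff₀ hcpos] at hk
    rw [lt_abs] at hk
    rcases hk with hk | hk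
    · left; simp only [Set.mem_ofPred_eq]; linarith
    · right; simp only [Set.mem_ofPred_eq, neg_mul, Finset.sum_neg_distrib]; linarith
  have hcompl : μ.real Sᶜ ≤ 1/2 := by
    calc μ.real Sᶜ ≤ μ.real (⋃ k : Fin n, ({ω | 5 * Real.sqrt (m * Real.log n) ≤ ∑ ℓ, q k ℓ * ω ℓ (k' k ℓ)} ∪
      {ω | 5 * Real.sqrt (m * Real.log n) ≤ ∑ ℓ, (-q k ℓ) * ω ℓ (k' k ℓ)})) := measureReal_mono hsub
      _ ≤ ∑ k : Fin n, μ.real (({ω | 5 * Real.sqrt (m * Real.log n) ≤ ∑ ℓ, q k ℓ * ω ℓ (k' k ℓ)} ∪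
      {ω | 5 * Real.sqrt (m * Real.log n) ≤ ∑ ℓ, (-q k ℓ) * ω ℓ (k' k ℓ)})) := measureReal_iUnion_fintype_le _
      _ ≤ ∑ k : Fin n, (1 / (n:ℝ)^3 + 1 / (n:ℝ)^3) := by
        apply Finset.sum_le_sum
        intro k _
        refine (measureReal_union_le _ _).trans (add_le_add ?_ ?_)
        · exact hoeff hn hm (q k) (hq k) (k' k)
        · exact hoeff hn hm (fun ℓ => - q k ℓ) (fun ℓ => by rw [abs_neg]; exact hq k ℓ) (k' k)
      _ = 2 / (n:ℝ)^2 := by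
        rw [Finset.sum_const, Finset.card_univ, Fintype.card_fin, nsmul_eq_mul]
        field_simp; norm_num
      _ ≤ 1/2 := by
        have : (2:ℝ) ≤ n := by exact_mod_cast hn
        rw [div_le_iff₀ (by positivity)]; nlinarith
  rw [measureReal_compl hSm] at hcompl
  simp at hcompl
  have h2 : (1/2:ℝ) ≤ μ.real S := by linarith
  have : (2⁻¹ : ENNReal) = ENNReal.ofReal (1/2) := by
    rw [one_div, ENNReal.ofReal_inv_of_pos (by norm_num)]; simp
  rw [this, ← ofReal_measureReal]
  exact ENNReal.ofReal_le_ofReal h2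

lemma bias_affine {n m : ℕ} (v : Fin m → Fin n → ℝ) (ℓ0 : Fin m) (i : ℤ)
    (hi : (binClass (v ℓ0) i).Nonempty) (ω : Fin m → Fin n → ℝ) (z : Fin n → ℝ) :
    ∃ A : Fin n → ℝ, ∀ y : ℝ,
      biasP n m v (alphaOf v (Function.update ω ℓ0 (Function.update z ((binClass (v ℓ0) i).min' hi) y)))
        = fun k => A k + y * (if k ∈ binClass (v ℓ0) i then
            (10 * Real.sqrt (m * Real.log n))⁻¹ * ((2:ℝ) ^ (-i))⁻¹ * v ℓ0 k else 0) := by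
  refine ⟨fun k => biasP n m v (alphaOf v (Function.update ω ℓ0 (Function.update z ((binClass (v ℓ0) i).min' hi) 0))) k, fun y => ?_⟩
  funext k
  unfold biasP
  beta_reduce
  rw [← Finset.add_sum_erase _ _ (Finset.mem_univ ℓ0), ← Finset.add_sum_erase _ (fun ℓ => ∑ᶠ j : ℤ, alphaOf v (Function.update ω ℓ0 (Function.update z ((binClass (v ℓ0) i).min' hi) 0)) ℓ j * (2 : ℝ) ^ j * binComp (v ℓ) j k) (Finset.mem_univ ℓ0)]
  have h1 : ∀ y y' : ℝ, ∑ x ∈ Finset.univ.erase ℓ0, ∑ᶠ j : ℤ, alphaOf v (Function.update ω ℓ0 (Function.update z ((binClass (v ℓ0) i).min' hi) y)) x j * (2 : ℝ) ^ j * binComp (v x) j k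
     = ∑ x ∈ Finset.univ.erase ℓ0, ∑ᶠ j : ℤ, alphaOf v (Function.update ω ℓ0 (Function.update z ((binClass (v ℓ0) i).min' hi) y')) x j * (2 : ℝ) ^ j * binComp (v x) j k := by
    intro y y'
    apply Finset.sum_congr rfl
    intro x hx
    unfold alphaOf
    simp only [Function.update_of_ne (Finset.ne_of_mem_erase hx)]
  rw [h1 y 0]
  by_cases hk : k ∈ binClass (v ℓ0) i
  · simp only [fs_mem hk]
    unfold alphaOf
    rw [if_pos hk]
    simp [hi, zpow_neg]
    ring
  · rw [if_neg hk]
    by_cases h0 : v ℓ0 k = 0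
    · simp only [fs_zero h0]; ring
    · obtain ⟨j, hj⟩ := binClass_exists h0
      simp only [fs_mem hj]
      have hne : (binClass (v ℓ0) j).min' ⟨k, hj⟩ ≠ (binClass (v ℓ0) i).min' hi := by
        intro h
        have a1 := (binClass (v ℓ0) j).min'_mem ⟨k, hj⟩
        have a2 := (binClass (v ℓ0) i).min'_mem hi
        rw [h] at a1
        have := binClass_unique a1 a2
        subst this
        exact hk hj
      have hJ : (binClass (v ℓ0) j).Nonempty := ⟨k, hj⟩
      unfold alphaOf
      simp only [dif_pos hJ, Function.update_self, Function.update_of_ne hne]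
      ring

lemma EE_meas {n : ℕ} (f : (Fin n → Bool) → ℝ) : Continuous (fun p : Fin n → ℝ => EE p f) := by
  unfold EE wt; fun_prop

lemma mainB {n m : ℕ} (hn : 2 ≤ n) (hm : 2 ≤ m) (v : Fin m → Fin n → ℝ) (ℓ0 : Fin m) (i : ℤ)
    (hi : (binClass (v ℓ0) i).Nonempty) (t : ℝ) :
    ((binClass (v ℓ0) i).card : ENNReal) * ∫⁻ a in {a | ∀ k, |biasP n m v a k| ≤ 1 / 2},
      ENNReal.ofReal (EE (biasP n m v a) (win (v ℓ0) t (2 * 2 ^ (-i)))) ∂(alphaMeasure n m v) ≤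
      ENNReal.ofReal (140 * Real.sqrt (m * Real.log n)) := by
  have hlog : 0 < Real.log n := Real.log_pos (by exact_mod_cast hn)
  have hm0 : (0:ℝ) < m := by positivity
  have hD := meas_D n m v
  set D := {a | ∀ k, |biasP n m v a k| ≤ 1 / 2} with hDdef
  set g : (Fin m → ℤ → ℝ) → ENNReal := D.indicator (fun a => ENNReal.ofReal (EE (biasP n m v a) (win (v ℓ0) t (2 * 2 ^ (-i))))) with hg
  have hgm : Measurable g := by
    apply Measurable.indicator _ hD
    apply ENNReal.measurable_ofReal.comp
    exact (EE_meas _).measurable.comp (measurable_pi_iff.2 (meas_bias n m v))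
  have hf : Measurable (fun ω => g (alphaOf v ω)) := hgm.comp (meas_alphaOf v)
  rw [← lintegral_indicator hD]
  unfold alphaMeasure
  rw [lintegral_map hgm (meas_alphaOf v), resample _ ℓ0 _ hf, ← lintegral_const_mul' _ _ (by simp)]
  set B := ENNReal.ofReal (140 * Real.sqrt (m * Real.log n)) with hB
  set K := binClass (v ℓ0) i with hK
  have inner : ∀ ω : Fin m → Fin n → ℝ, (K.card : ENNReal) * ∫⁻ z, g (alphaOf v (Function.update ω ℓ0 z)) ∂(Measure.pi fun _ : Fin n => unifInterval) ≤ B := by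
    intro ω
    have hf2 : Measurable (fun z : Fin n → ℝ => g (alphaOf v (Function.update ω ℓ0 z))) :=
      hf.comp (measurable_update ω)
    rw [resample _ (K.min' hi) _ hf2, ← lintegral_const_mul' _ _ (by simp)]
    have inner2 : ∀ z : Fin n → ℝ, (K.card : ENNReal) * ∫⁻ y, g (alphaOf v (Function.update ω ℓ0 (Function.update z (K.min' hi) y))) ∂unifInterval ≤ B := by
      intro z
      obtain ⟨A, hA⟩ := bias_affine v ℓ0 i hi ω z
      set b : Fin n → ℝ := fun k => if k ∈ binClass (v ℓ0) i then
            (10 * Real.sqrt (m * Real.log n))⁻¹ * ((2:ℝ) ^ (-i))⁻¹ * v ℓ0 k else 0 with hb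
      have hpB := partB A (v ℓ0) K b (10 * Real.sqrt (m * Real.log n))⁻¹ (2 ^ (-i)) (by positivity)
        (by positivity) (by
          intro k hk
          simp only [hK, binClass, Finset.mem_filter, Finset.mem_univ, true_and] at hk
          rw [zpow_sub₀ (by norm_num)] at hk
          simpa using hk) (fun k => rfl) t
      set I := {y : ℝ | y ∈ Set.Icc (-1:ℝ) 1 ∧ ∀ k, |A k + y * b k| ≤ 1/2} with hI
      have hIm : MeasurableSet {y : ℝ | ∀ k, |A k + y * b k| ≤ 1/2} := by
        rw [Set.ofPred_forall]
        exact MeasurableSet.iInter fun k => measurableSet_le (by fun_prop) (by fun_prop)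
      have e : ∀ y, g (alphaOf v (Function.update ω ℓ0 (Function.update z (K.min' hi) y))) =
          ({y : ℝ | ∀ k, |A k + y * b k| ≤ 1/2}).indicator (fun y => ENNReal.ofReal (EE (fun k => A k + y * b k) (win (v ℓ0) t (2 * 2 ^ (-i))))) y := by
        intro y
        have hmem : alphaOf v (Function.update ω ℓ0 (Function.update z (K.min' hi) y)) ∈ D ↔
            y ∈ {y : ℝ | ∀ k, |A k + y * b k| ≤ 1/2} := by
          simp only [hDdef, Set.mem_ofPred_eq]
          rw [hA y]
        by_cases hy : y ∈ {y : ℝ | ∀ k, |A k + y * b k| ≤ 1/2}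
        · rw [Set.indicator_of_mem hy, hg, Set.indicator_of_mem (hmem.2 hy), hA y]
        · rw [Set.indicator_of_notMem hy, hg, Set.indicator_of_notMem (fun h => hy (hmem.1 h))]
      simp_rw [e]
      unfold unifInterval
      rw [lintegral_smul_measure, lintegral_indicator hIm, Measure.restrict_restrict hIm]
      have e2 : {y : ℝ | ∀ k, |A k + y * b k| ≤ 1/2} ∩ Set.Icc (-1:ℝ) 1 = I := by
        ext y; simp [hI, and_comm]
      rw [e2, smul_eq_mul, mul_left_comm]
      calc _ ≤ (2⁻¹ : ENNReal) * ENNReal.ofReal (28 / (10 * Real.sqrt (m * Real.log n))⁻¹) := by gcongr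
        _ = B := by
          have : (2⁻¹ : ENNReal) = ENNReal.ofReal (1/2) := by
            rw [one_div, ENNReal.ofReal_inv_of_pos (by norm_num)]; simp
          rw [this, ← ENNReal.ofReal_mul (by norm_num), hB]
          congr 1
          field_simp; norm_num
    calc _ ≤ ∫⁻ z, B ∂(Measure.pi fun _ : Fin n => unifInterval) := lintegral_mono inner2
      _ = B := by simp
  calc _ ≤ ∫⁻ ω, B ∂(Measure.pi fun _ : Fin m => Measure.pi fun _ : Fin n => unifInterval) := lintegral_mono inner
    _ = B := by simp

lemma joint_le {n m : ℕ} (v : Fin m → Fin n → ℝ) (u : Fin n → ℝ) (t w : ℝ) :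
    biasJoint n m v {q | |(∑ j, u j * q.2 j) - t| < w} ≤
      (alphaMeasure n m v {a | ∀ k, |biasP n m v a k| ≤ 1 / 2})⁻¹ *
        ∫⁻ a in {a | ∀ k, |biasP n m v a k| ≤ 1 / 2},
          ENNReal.ofReal (EE (biasP n m v a) (win u t w)) ∂(alphaMeasure n m v) := by
  have hs : MeasurableSet {q : (Fin m → ℤ → ℝ) × (Fin n → ℝ) | |(∑ j, u j * q.2 j) - t| < w} :=
    measurable_snd (meas_win u t w)
  unfold biasJoint
  refine (Measure.bind_apply_le _ hs).trans ?_
  unfold ProbabilityTheory.cond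
  rw [lintegral_smul_measure, smul_eq_mul]
  refine mul_le_mul_right ?_ _
  apply setLIntegral_mono' (meas_D n m v)
  intro a ha
  rw [Measure.map_apply (by fun_prop) hs]
  exact (cube_win (biasP n m v a) (fun k => (ha k).trans (by norm_num)) u t w).le

lemma exp_bound {n r N : ℕ} (hn : 2 ≤ n) (hr : 4 ≤ r) (M : ℕ) (hN : 2 * r * Real.log n ≤ N)
    (hM : N ≤ 2 * (M + 1)) : (3/4:ℝ) ^ M ≤ (4/3) / n := by
  have hlog : 0 < Real.log n := Real.log_pos (by exact_mod_cast hn)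
  have hr' : (4:ℝ) ≤ r := by exact_mod_cast hr
  have hM' : (N:ℝ) ≤ 2 * (M + 1) := by exact_mod_cast hM
  have h1 : 4 * Real.log n ≤ M + 1 := by nlinarith
  have hL : 1/4 ≤ Real.log (4/3) := by
    have := Real.one_sub_inv_le_log_of_pos (by norm_num : (0:ℝ) < 4/3)
    norm_num at this ⊢; linarith
  have h2 : (3/4:ℝ) ^ (M + 1) ≤ 1 / n := by
    have e : (3/4:ℝ) ^ (M+1) = Real.exp (-(((M + 1 : ℕ):ℝ) * Real.log (4/3))) := by
      rw [Real.exp_neg, Real.exp_nat_mul, Real.exp_log (by norm_num), ← inv_pow]; norm_num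
    have e2 : (1:ℝ) / n = Real.exp (- Real.log n) := by
      rw [Real.exp_neg, Real.exp_log (by positivity), one_div]
    rw [e, e2]
    apply Real.exp_le_exp.2
    push_cast
    nlinarith
  rw [pow_succ] at h2
  have : (4/3:ℝ) / n = 4/3 * (1 / n) := by ring
  rw [this]; linarith

lemma choose_T (S : Finset ℤ) (i : ℤ) (h : ∀ j ∈ S, j < i) :
    ∃ (c : ℤ) (T : Finset ℤ), T ⊆ S ∧ (∀ j ∈ T, j ≤ i - 2) ∧ (∀ j ∈ T, j % 2 = c) ∧
      S.card ≤ 2 * (T.card + 1) := by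
  have hc : (S.filter (fun j => j % 2 = 0)).card + (S.filter (fun j => ¬ j % 2 = 0)).card = S.card :=
    Finset.card_filter_add_card_filter_not _
  have key : ∀ (c : ℤ) (U : Finset ℤ), U ⊆ S → (∀ j ∈ U, j % 2 = c) → S.card ≤ 2 * U.card →
      ∃ (c : ℤ) (T : Finset ℤ), T ⊆ S ∧ (∀ j ∈ T, j ≤ i - 2) ∧ (∀ j ∈ T, j % 2 = c) ∧
      S.card ≤ 2 * (T.card + 1) := by
    intro c U hU hUc hcard
    refine ⟨c, U.erase (i - 1), (Finset.erase_subset _ _).trans hU, ?_, ?_, ?_⟩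
    · intro j hj
      rw [Finset.mem_erase] at hj
      have := h j (hU hj.2)
      have := hj.1
      omega
    · intro j hj; exact hUc j (Finset.mem_of_mem_erase hj)
    · have := Finset.pred_card_le_card_erase (s := U) (a := i - 1)
      omega
  by_cases hh : S.card ≤ 2 * (S.filter (fun j => j % 2 = 0)).card
  · exact key 0 _ (Finset.filter_subset _ _) (fun j hj => (Finset.mem_filter.1 hj).2) hh
  · refine key 1 _ (Finset.filter_subset (fun j => ¬ j % 2 = 0) S) (fun j hj => ?_) (by omega)
    have := (Finset.mem_filter.1 hj).2
    omega

/-- inequality (11), the key estimate in the proof of Lemma 2.13: there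
is an absolute constant `C > 0` such that the following holds. Let `n, m ≥ 2`, let
`v̄_1, …, v̄_m ∈ ℝ^n` be unit vectors, let `P` be the random bias vector of
Definition 2.2 conditioned on `‖P‖_∞ ≤ 1/2`, and let `x ~ μ_P`. Write `v = v̄_1`, with
dyadic classes `K(j)` and index set `J`. If `i ∈ J` and at least `2r·log n` elements of
`J` are smaller than `i` (`r ≥ 0` an integer), then for every `t ∈ ℝ`,
`∑_{k ∈ K(i)} Pr[|⟨v,x⟩ - t| < 2|v_k|] ≤ C·(2^{-r}·√m·log n + |K(i)|/n)`, the
probability being over both `P` and `x ~ μ_P`. -/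
theorem stmt_11 :
    ∃ C : ℝ, 0 < C ∧
      ∀ (n m : ℕ) (hn : 2 ≤ n) (hm : 2 ≤ m)
        (v : Fin m → Fin n → ℝ) (hv : ∀ ℓ, ∑ i, v ℓ i ^ 2 = 1)
        (i : ℤ) (hi : i ∈ binIdx (v ⟨0, by omega⟩)) (r : ℕ)
        (hr : ∃ S : Finset ℤ, ↑S ⊆ binIdx (v ⟨0, by omega⟩) ∧ (∀ j ∈ S, j < i) ∧
          2 * r * Real.log n ≤ S.card)
        (t : ℝ),
        ∑ k ∈ binClass (v ⟨0, by omega⟩) i,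
            biasJoint n m v
              {q | |(∑ j, v ⟨0, by omega⟩ j * q.2 j) - t| < 2 * |v ⟨0, by omega⟩ k|} ≤
          ENNReal.ofReal (C * (Real.sqrt m * Real.log n / 2 ^ r +
            (binClass (v ⟨0, by omega⟩) i).card / n)) := by
  refine ⟨4480, by norm_num, ?_⟩
  intro n m hn hm v hv i hi r hr t
  have hlog : 0 < Real.log n := Real.log_pos (by exact_mod_cast hn)
  set ℓ0 : Fin m := ⟨0, by omega⟩ with hℓ0
  set K := binClass (v ℓ0) i with hK
  set D := {a | ∀ k, |biasP n m v a k| ≤ 1 / 2} with hD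
  have hDm : MeasurableSet D := meas_D n m v
  set Z := alphaMeasure n m v D with hZ
  set Q := ∫⁻ a in D, ENNReal.ofReal (EE (biasP n m v a) (win (v ℓ0) t (2 * 2 ^ (-i)))) ∂(alphaMeasure n m v) with hQ
  have hZl : (2⁻¹ : ENNReal) ≤ Z := Z_lower hn hm v
  have hbd : ∑ k ∈ K, biasJoint n m v {q | |(∑ j, v ℓ0 j * q.2 j) - t| < 2 * |v ℓ0 k|} ≤
      K.card * (Z⁻¹ * Q) := by
    rw [← nsmul_eq_mul]
    apply Finset.sum_le_card_nsmul
    intro k hk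
    refine le_trans (measure_mono ?_) (joint_le v (v ℓ0) t (2 * 2 ^ (-i)))
    intro q hq
    simp only [hK, binClass, Finset.mem_filter, Finset.mem_univ, true_and] at hk
    simp only [Set.mem_ofPred_eq] at hq ⊢
    linarith [hk.2]
  refine hbd.trans ?_
  by_cases h4 : 4 ≤ r
  · obtain ⟨S, hS1, hS2, hS3⟩ := hr
    obtain ⟨c, T, hT1, hT2, hT3, hT4⟩ := choose_T S i hS2
    have hb := exp_bound hn h4 T.card hS3 hT4
    have hQle : Q ≤ ENNReal.ofReal ((4/3) / n) * Z := by
      calc Q ≤ ∫⁻ a in D, ENNReal.ofReal ((4/3) / n) ∂(alphaMeasure n m v) := by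
            apply setLIntegral_mono' hDm
            intro a ha
            apply ENNReal.ofReal_le_ofReal
            refine le_trans (partA ha t c T i (v ℓ0) _ le_rfl hT2 hT3 ?_) hb
            intro j hj
            obtain ⟨k, hk⟩ := hS1 (hT1 hj)
            simp only [binClass, Finset.mem_filter, Finset.mem_univ, true_and] at hk
            exact ⟨k, hk⟩
        _ = _ := by rw [setLIntegral_const]
    calc (K.card : ENNReal) * (Z⁻¹ * Q) ≤ K.card * (Z⁻¹ * (ENNReal.ofReal ((4/3) / n) * Z)) := by gcongr
      _ = K.card * (ENNReal.ofReal ((4/3) / n) * (Z⁻¹ * Z)) := by ring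
      _ ≤ K.card * (ENNReal.ofReal ((4/3) / n) * 1) := by
          gcongr; exact ENNReal.inv_mul_le_one _
      _ = ENNReal.ofReal (K.card * ((4/3) / n)) := by
          rw [mul_one, ENNReal.ofReal_mul (Nat.cast_nonneg _), ENNReal.ofReal_natCast]
      _ ≤ _ := by
          apply ENNReal.ofReal_le_ofReal
          have h1 : 0 ≤ Real.sqrt m * Real.log n / 2 ^ r := by positivity
          have h2 : 0 ≤ (K.card : ℝ) / n := div_nonneg (Nat.cast_nonneg _) (Nat.cast_nonneg _)
          have : (K.card : ℝ) * ((4/3) / n) = 4/3 * (K.card / n) := by ring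
          rw [this]; linarith
  · have hB := mainB hn hm v ℓ0 i hi t
    calc (K.card : ENNReal) * (Z⁻¹ * Q) = Z⁻¹ * (K.card * Q) := by ring
      _ ≤ 2 * ENNReal.ofReal (140 * Real.sqrt (m * Real.log n)) := by
          gcongr
          rw [ENNReal.inv_le_iff_inv_le]; exact hZl
      _ = ENNReal.ofReal (280 * Real.sqrt (m * Real.log n)) := by
          rw [← ENNReal.ofReal_ofNat, ← ENNReal.ofReal_mul (by norm_num)]
          congr 1; ring
      _ ≤ _ := by
          apply ENNReal.ofReal_le_ofReal
          have h2 : 0 ≤ (K.card : ℝ) / n := div_nonneg (Nat.cast_nonneg _) (Nat.cast_nonneg _)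
          have hl2 : 1/4 ≤ Real.log n := by
            have : Real.log 2 ≤ Real.log n := Real.log_le_log (by norm_num) (by exact_mod_cast hn)
            linarith [Real.log_two_gt_d9]
          have hs : Real.sqrt (Real.log n) ≤ 2 * Real.log n := by
            rw [Real.sqrt_le_left (by positivity)]; nlinarith
          have h8 : (2:ℝ) ^ r ≤ 8 := by
            have : (2:ℝ) ^ r ≤ 2 ^ 3 := pow_le_pow_right₀ (by norm_num) (by omega)
            linarith
          have h3 : Real.sqrt m * Real.log n / 8 ≤ Real.sqrt m * Real.log n / 2 ^ r := by gcongr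
          rw [Real.sqrt_mul (Nat.cast_nonneg _)]
          have h4 := mul_le_mul_of_nonneg_left hs (Real.sqrt_nonneg (m:ℝ))
          linarith
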